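/- For every real ν > 0, every real t > 0, and every complex number z, the series ∑_{m=0}^∞ ((−1)^m · e^{−t} L_m^{ν−1}(2t) / (2^m · (ν)_m)) · z^m converges absolutely and its sum equals e^{−t} · e^{−z/2} · ∑_{k=0}^∞ (t·z)^k / (k! · (ν)_k), the latter series also converging absolutely. -/

import Mathlib

/-- The generalized Laguerre polynomial
`L_n^α(x) = ∑_{k=0}^n ((−1)^k / k!) ((α+k+1)_{n−k} / (n−k)!) x^k`. -/
noncomputable def laguerreL (α : ℝ) (n : ℕ) (x : ℝ) : ℝ :=
  ∑ k ∈ Finset.range (n + 1),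
    ((-1 : ℝ) ^ k / (Nat.factorial k)) *
      ((ascPochhammer ℝ (n - k)).eval (α + (k : ℝ) + 1) / (Nat.factorial (n - k))) * x ^ k

theorem pow_le_ascPochhammer_eval {x : ℝ} (hx : 0 ≤ x) (n : ℕ) :
    x ^ n ≤ (ascPochhammer ℝ n).eval x := by
  induction n with
  | zero => simp
  | succ n ih =>
    rw [ascPochhammer_succ_eval, pow_succ]
    exact mul_le_mul ih (le_add_of_nonneg_right n.cast_nonneg) hx ((pow_nonneg hx n).trans ih)

theorem ascPochhammer_eval_add {S : Type*} [CommSemiring S] (x : S) (k j : ℕ) :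
    (ascPochhammer S (k + j)).eval x =
      (ascPochhammer S k).eval x * (ascPochhammer S j).eval (x + k) := by
  simp [← ascPochhammer_mul]

theorem summable_norm_bessel_series {ν : ℝ} (hν : 0 < ν) (w : ℂ) :
    Summable fun k : ℕ =>
      ‖w ^ k / ((Nat.factorial k : ℂ) * (((ascPochhammer ℝ k).eval ν : ℝ) : ℂ))‖ := by
  refine .of_nonneg_of_le (fun _ => norm_nonneg _) (fun k => ?_)
    (Real.summable_pow_div_factorial (‖w‖ / ν))
  rw [norm_div, norm_mul, norm_pow, Complex.norm_natCast, Complex.norm_real,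
    Real.norm_of_nonneg (ascPochhammer_pos k ν hν).le, div_pow, div_div, mul_comm (ν ^ k)]
  gcongr
  exact pow_le_ascPochhammer_eval hν.le k

theorem laguerre_term_eq_cauchy_product {ν : ℝ} (hν : 0 < ν) (t : ℝ) (z : ℂ) (m : ℕ) :
    (((-1 : ℂ) ^ m * ((Real.exp (-t) * laguerreL (ν - 1) m (2 * t) : ℝ) : ℂ)) /
        ((2 : ℂ) ^ m * (((ascPochhammer ℝ m).eval ν : ℝ) : ℂ))) * z ^ m =
      ((Real.exp (-t) : ℝ) : ℂ) * ∑ k ∈ Finset.range (m + 1),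
        ((t : ℂ) * z) ^ k / ((Nat.factorial k : ℂ) * (((ascPochhammer ℝ k).eval ν : ℝ) : ℂ)) *
          ((-z / 2) ^ (m - k) / (Nat.factorial (m - k) : ℂ)) := by
  rw [laguerreL, Complex.ofReal_mul, mul_left_comm, mul_div_assoc, mul_assoc,
    Complex.ofReal_sum, Finset.mul_sum, Finset.sum_div, Finset.sum_mul]
  congr 1
  refine Finset.sum_congr rfl fun k hk => ?_
  obtain ⟨j, rfl⟩ := Nat.exists_eq_add_of_le (Finset.mem_range_succ_iff.mp hk)
  have hk0 : (((ascPochhammer ℝ k).eval ν : ℝ) : ℂ) ≠ 0 :=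
    Complex.ofReal_ne_zero.mpr (ascPochhammer_pos k ν hν).ne'
  have hj0 : (((ascPochhammer ℝ j).eval (ν + k) : ℝ) : ℂ) ≠ 0 :=
    Complex.ofReal_ne_zero.mpr (ascPochhammer_pos j _ (by positivity)).ne'
  have hkf : (Nat.factorial k : ℂ) ≠ 0 := Nat.cast_ne_zero.mpr k.factorial_ne_zero
  have hjf : (Nat.factorial j : ℂ) ≠ 0 := Nat.cast_ne_zero.mpr j.factorial_ne_zero
  have hsign : (-1 : ℂ) ^ k * (-1) ^ k = 1 := by rw [← mul_pow]; norm_num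
  rw [Nat.add_sub_cancel_left, ascPochhammer_eval_add, show ν - 1 + (k : ℝ) + 1 = ν + k by ring]
  push_cast
  rw [neg_div, neg_pow (z / 2), div_pow, pow_add, pow_add, pow_add, mul_pow, mul_pow]
  field_simp
  linear_combination (t : ℂ) ^ k * z ^ k * z ^ j * hsign

/-- K-type expansion of the Whittaker vector in the Fock model:
`∑_m ((-1)^m ℓ_m^ν(t)/(2^m (ν)_m)) z^m = e^{-t} e^{-z/2} I_ν(tz)` where
`I_ν(w) = ∑_k w^k/(k!(ν)_k)`. -/
theorem whittaker_fock_model_expansion (ν : ℝ) (hν : 0 < ν) (t : ℝ) (ht : 0 < t)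
    (z : ℂ) :
    (Summable fun m : ℕ =>
      ‖(((-1 : ℂ) ^ m * ((Real.exp (-t) * laguerreL (ν - 1) m (2 * t) : ℝ) : ℂ)) /
          ((2 : ℂ) ^ m * (((ascPochhammer ℝ m).eval ν : ℝ) : ℂ))) * z ^ m‖) ∧
    (Summable fun k : ℕ =>
      ‖((t : ℂ) * z) ^ k / ((Nat.factorial k : ℂ) * (((ascPochhammer ℝ k).eval ν : ℝ) : ℂ))‖) ∧
    (∑' m : ℕ,
      (((-1 : ℂ) ^ m * ((Real.exp (-t) * laguerreL (ν - 1) m (2 * t) : ℝ) : ℂ)) /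
          ((2 : ℂ) ^ m * (((ascPochhammer ℝ m).eval ν : ℝ) : ℂ))) * z ^ m
      = ((Real.exp (-t) : ℝ) : ℂ) * Complex.exp (-z / 2) *
        ∑' k : ℕ, ((t : ℂ) * z) ^ k /
          ((Nat.factorial k : ℂ) * (((ascPochhammer ℝ k).eval ν : ℝ) : ℂ))) := by
  have hB := summable_norm_bessel_series hν ((t : ℂ) * z)
  have hE : Summable fun n : ℕ => ‖(-z / 2) ^ n / (Nat.factorial n : ℂ)‖ :=
    NormedSpace.norm_expSeries_div_summable (-z / 2)
  simp only [laguerre_term_eq_cauchy_product hν]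
  refine ⟨?_, hB, ?_⟩
  · simp only [norm_mul (Complex.ofReal _)]
    exact (summable_norm_sum_mul_range_of_summable_norm hB hE).mul_left _
  · rw [tsum_mul_left, ← tsum_mul_tsum_eq_tsum_sum_range_of_summable_norm hB hE,
      Complex.exp_eq_exp_ℂ, NormedSpace.exp_eq_tsum_div, mul_assoc, mul_comm (tsum _)]
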